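/- For every A = (a_{ij}) ∈ M_n(ℤ≥0), the bar involution acts triangularly on the monomial basis: bar(x^A) = E(A)·x^A + Σ_B c_{BA}·x^B, where E(A) = q^{−2(Σ_i Σ_{j>k} a_{ij}a_{ik} + Σ_i Σ_{j>k} a_{ji}a_{ki})}, each c_{BA} ∈ ℤ[q, q^{−1}], and c_{BA} is nonzero only if B < A. -/

import Mathlib

open scoped TensorProduct

set_option synthInstance.maxHeartbeats 1000000
set_option maxHeartbeats 1000000

noncomputable section

/-- The base field `K = ℚ(q)`. -/
abbrev Kq : Type := RatFunc ℚ

/-- The indeterminate `q ∈ ℚ(q)`. -/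
noncomputable def qq : Kq := RatFunc.X

/-- Matrices with nonnegative integer entries. -/
abbrev Mat (n : ℕ) := Matrix (Fin n) (Fin n) ℕ

/-- The defining relations of the quantum matrix algebra `O_q(M(n))`. -/
inductive OqRel (n : ℕ) :
    FreeAlgebra Kq (Fin n × Fin n) → FreeAlgebra Kq (Fin n × Fin n) → Prop
  | rel_row {i j k : Fin n} (h : j < k) :
      OqRel n (FreeAlgebra.ι Kq (i, j) * FreeAlgebra.ι Kq (i, k))
        ((qq ^ 2) • (FreeAlgebra.ι Kq (i, k) * FreeAlgebra.ι Kq (i, j)))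
  | rel_col {i k j : Fin n} (h : i < k) :
      OqRel n (FreeAlgebra.ι Kq (i, j) * FreeAlgebra.ι Kq (k, j))
        ((qq ^ 2) • (FreeAlgebra.ι Kq (k, j) * FreeAlgebra.ι Kq (i, j)))
  | rel_anti {i j s t : Fin n} (h1 : s < i) (h2 : j < t) :
      OqRel n (FreeAlgebra.ι Kq (i, j) * FreeAlgebra.ι Kq (s, t))
        (FreeAlgebra.ι Kq (s, t) * FreeAlgebra.ι Kq (i, j))
  | rel_diag {i j s t : Fin n} (h1 : i < s) (h2 : j < t) :
      OqRel n (FreeAlgebra.ι Kq (i, j) * FreeAlgebra.ι Kq (s, t))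
        (FreeAlgebra.ι Kq (s, t) * FreeAlgebra.ι Kq (i, j)
          + (qq ^ 2 - qq⁻¹ ^ 2) • (FreeAlgebra.ι Kq (i, t) * FreeAlgebra.ι Kq (s, j)))

/-- The quantum matrix algebra `O_q(M(n))`. -/
abbrev Oq (n : ℕ) := RingQuot (OqRel n)

/-- The generator `x_{ij}` of `O_q(M(n))`. -/
noncomputable def xgen (n : ℕ) (i j : Fin n) : Oq n :=
  RingQuot.mkAlgHom Kq (OqRel n) (FreeAlgebra.ι Kq (i, j))

/-- The lexicographically ordered monomial `x^A`. -/
noncomputable def xMon (n : ℕ) (A : Mat n) : Oq n :=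
  ((List.finRange n).map fun i =>
    ((List.finRange n).map fun j => xgen n i j ^ A i j).prod).prod
/-- The exponent appearing in `E(A)` and `D(A)`. -/
def eExp (n : ℕ) (A : Mat n) : ℕ :=
  ∑ i, ∑ j, ∑ k ∈ Finset.univ.filter (fun k => k < j), (A i j * A i k + A j i * A k i)

/-- The modified monomial `x(A) = D(A) x^A`. -/
noncomputable def xMod (n : ℕ) (A : Mat n) : Oq n := (qq ^ (-(eExp n A : ℤ))) • xMon n A

/-- `matStep M M'` : `M'` is obtained from `M` by a single 2×2 submatrix transformation. -/
def matStep (n : ℕ) (M M' : Mat n) : Prop :=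
  ∃ i s j t : Fin n, i < s ∧ j < t ∧ 1 ≤ M i j ∧ 1 ≤ M s t ∧
    M' i j = M i j - 1 ∧ M' s t = M s t - 1 ∧ M' i t = M i t + 1 ∧ M' s j = M s j + 1 ∧
    ∀ u v : Fin n,
      ¬((u = i ∧ v = j) ∨ (u = s ∧ v = t) ∨ (u = i ∧ v = t) ∨ (u = s ∧ v = j)) →
        M' u v = M u v

/-- `matLT B A` : `B < A`, i.e. `B` is obtained from `A` by a nonempty sequence of
2×2 submatrix transformations. -/
def matLT (n : ℕ) (B A : Mat n) : Prop := Relation.TransGen (matStep n) A B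

/-- Membership in `ℤ[q] ⊆ ℚ(q)`. -/
def inZq (c : Kq) : Prop := c ∈ Subring.closure ({qq} : Set Kq)

/-- Membership in `qℤ[q] ⊆ ℚ(q)`. -/
def inQZq (c : Kq) : Prop := ∃ d : Kq, inZq d ∧ c = qq * d

/-- Membership in `ℤ[q, q⁻¹] ⊆ ℚ(q)`. -/
def inZLaurent (c : Kq) : Prop := c ∈ Subring.closure ({qq, qq⁻¹} : Set Kq)

/-- `bar` is the bar involution: a `ℚ`-algebra anti-automorphism fixing the `x_{ij}`
and semilinear with respect to `q ↦ q⁻¹`. -/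
def IsBar (n : ℕ) (bar : Oq n → Oq n) : Prop :=
  Function.Bijective bar ∧
  (∀ a b : Oq n, bar (a + b) = bar a + bar b) ∧
  (∀ (r : ℚ) (a : Oq n), bar ((r : Kq) • a) = (r : Kq) • bar a) ∧
  (∀ a b : Oq n, bar (a * b) = bar b * bar a) ∧
  bar 1 = 1 ∧
  (∀ i j, bar (xgen n i j) = xgen n i j) ∧
  (∀ a : Oq n, bar (qq • a) = qq⁻¹ • bar a)

/-- Membership in the `ℤ[q]`-lattice `L* = ⊕_A ℤ[q]·x(A)`. -/
def memLstar (n : ℕ) (v : Oq n) : Prop :=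
  ∃ (F : Finset (Mat n)) (h : Mat n → Kq),
    (∀ A ∈ F, inZq (h A)) ∧ v = ∑ A ∈ F, h A • xMod n A

/-- `b` is the dual canonical basis of `O_q(M(n))` relative to the bar involution `bar`:
each `b A` is bar-invariant, is `x(A)` plus a `qℤ[q]`-combination of `x(B)` with `B < A`,
and the family is a `ℤ[q]`-basis of `L*`. -/
def IsDCB (n : ℕ) (bar : Oq n → Oq n) (b : Mat n → Oq n) : Prop :=
  (∀ A, bar (b A) = b A) ∧
  (∀ A, ∃ (F : Finset (Mat n)) (h : Mat n → Kq),
      (∀ B ∈ F, matLT n B A ∧ inQZq (h B)) ∧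
      b A = xMod n A + ∑ B ∈ F, h B • xMod n B) ∧
  (∀ v, memLstar n v → ∃ (F : Finset (Mat n)) (h : Mat n → Kq),
      (∀ A ∈ F, inZq (h A)) ∧ v = ∑ A ∈ F, h A • b A) ∧
  (∀ (F : Finset (Mat n)) (h : Mat n → Kq), (∀ A ∈ F, inZq (h A)) →
      ∑ A ∈ F, h A • b A = 0 → ∀ A ∈ F, h A = 0)

theorem qq_ne_zero : qq ≠ 0 := RatFunc.X_ne_zero

/-- The additive subgroup generated by all `q`-power multiples of elements of `S`. -/
def qSpan (n : ℕ) (S : Set (Oq n)) : AddSubgroup (Oq n) :=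
  AddSubgroup.closure {v | ∃ k : ℤ, ∃ w ∈ S, v = qq ^ k • w}

theorem zpow_smul_mem_qSpan_of_mem {n : ℕ} {S : Set (Oq n)} (k : ℤ) {w : Oq n} (hw : w ∈ S) :
    qq ^ k • w ∈ qSpan n S :=
  AddSubgroup.subset_closure ⟨k, w, hw, rfl⟩

theorem subset_qSpan {n : ℕ} {S : Set (Oq n)} {w : Oq n} (hw : w ∈ S) : w ∈ qSpan n S := by
  simpa using zpow_smul_mem_qSpan_of_mem 0 hw

@[elab_as_elim]
theorem qSpan_induction {n : ℕ} {S : Set (Oq n)} {p : (v : Oq n) → v ∈ qSpan n S → Prop}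
    (mem : ∀ (k : ℤ) (w : Oq n) (hw : w ∈ S), p (qq ^ k • w) (zpow_smul_mem_qSpan_of_mem k hw))
    (zero : p 0 (zero_mem _))
    (add : ∀ u v hu hv, p u hu → p v hv → p (u + v) (add_mem hu hv))
    (neg : ∀ u hu, p u hu → p (-u) (neg_mem hu)) {v : Oq n} (hv : v ∈ qSpan n S) : p v hv := by
  induction hv using AddSubgroup.closure_induction with
  | mem v hv => obtain ⟨k, w, hw, rfl⟩ := hv; exact mem k w hw
  | zero => exact zero
  | add u v hu hv hu' hv' => exact add u v hu hv hu' hv'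
  | neg u hu hu' => exact neg u hu hu'

theorem zpow_smul_mem_qSpan {n : ℕ} {S : Set (Oq n)} (k : ℤ) {v : Oq n} (hv : v ∈ qSpan n S) :
    qq ^ k • v ∈ qSpan n S := by
  induction hv using qSpan_induction with
  | mem m w hw =>
    rw [smul_smul, ← zpow_add₀ qq_ne_zero]
    exact zpow_smul_mem_qSpan_of_mem _ hw
  | zero => rw [smul_zero]; exact zero_mem _
  | add u v _ _ hu hv => rw [smul_add]; exact add_mem hu hv
  | neg u _ hu => rw [smul_neg]; exact neg_mem hu

theorem qSpan_le {n : ℕ} {S T : Set (Oq n)} (h : ∀ w ∈ S, w ∈ qSpan n T) {v : Oq n}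
    (hv : v ∈ qSpan n S) : v ∈ qSpan n T := by
  induction hv using qSpan_induction with
  | mem m w hw => exact zpow_smul_mem_qSpan m (h w hw)
  | zero => exact zero_mem _
  | add u v _ _ hu hv => exact add_mem hu hv
  | neg u _ hu => exact neg_mem hu

theorem mul_mem_qSpan {n : ℕ} {S T : Set (Oq n)} (x : Oq n) (h : ∀ w ∈ S, x * w ∈ T) {v : Oq n}
    (hv : v ∈ qSpan n S) : x * v ∈ qSpan n T := by
  induction hv using qSpan_induction with
  | mem m w hw => rw [mul_smul_comm]; exact zpow_smul_mem_qSpan_of_mem m (h w hw)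
  | zero => rw [mul_zero]; exact zero_mem _
  | add u v _ _ hu hv => rw [mul_add]; exact add_mem hu hv
  | neg u _ hu =>
    have e : x * -u = -(x * u) := mul_neg x u
    rw [e]
    exact neg_mem hu

theorem xgen_row {n : ℕ} {i j k : Fin n} (h : j < k) :
    xgen n i j * xgen n i k = qq ^ 2 • (xgen n i k * xgen n i j) := by
  simpa [xgen] using RingQuot.mkAlgHom_rel Kq (OqRel.rel_row (i := i) h)

theorem xgen_col {n : ℕ} {i k j : Fin n} (h : i < k) :
    xgen n i j * xgen n k j = qq ^ 2 • (xgen n k j * xgen n i j) := by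
  simpa [xgen] using RingQuot.mkAlgHom_rel Kq (OqRel.rel_col (j := j) h)

theorem xgen_anti {n : ℕ} {i j s t : Fin n} (h1 : s < i) (h2 : j < t) :
    xgen n i j * xgen n s t = xgen n s t * xgen n i j := by
  simpa [xgen] using RingQuot.mkAlgHom_rel Kq (OqRel.rel_anti h1 h2)

theorem xgen_diag {n : ℕ} {i j s t : Fin n} (h1 : i < s) (h2 : j < t) :
    xgen n i j * xgen n s t = xgen n s t * xgen n i j
      + (qq ^ 2 - qq⁻¹ ^ 2) • (xgen n i t * xgen n s j) := by
  have h := RingQuot.mkAlgHom_rel Kq (OqRel.rel_diag h1 h2)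
  rw [map_mul, map_add, map_smul, map_mul, map_mul] at h
  exact h

/-- The product of generators along a word. -/
def wordProd {n : ℕ} (l : List (Fin n × Fin n)) : Oq n :=
  (l.map fun a => xgen n a.1 a.2).prod

/-- The matrix of multiplicities of the letters of a word. -/
def content {n : ℕ} (l : List (Fin n × Fin n)) : Mat n := fun i j => l.count (i, j)

theorem wordProd_cons {n : ℕ} (a : Fin n × Fin n) (l : List (Fin n × Fin n)) :
    wordProd (a :: l) = xgen n a.1 a.2 * wordProd l := by
  simp [wordProd]

theorem wordProd_append {n : ℕ} (l m : List (Fin n × Fin n)) :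
    wordProd (l ++ m) = wordProd l * wordProd m := by
  simp [wordProd]

theorem content_perm {n : ℕ} {l m : List (Fin n × Fin n)} (h : l.Perm m) :
    content l = content m := by
  ext i j; exact h.count_eq _

theorem content_cons {n : ℕ} (a : Fin n × Fin n) (l : List (Fin n × Fin n)) :
    content (a :: l) = content l + content [a] := by
  ext i j; simp [content, List.count_cons]

theorem matStep_add {n : ℕ} {M M' : Mat n} (N : Mat n) (h : matStep n M M') :
    matStep n (M + N) (M' + N) := by
  obtain ⟨i, s, j, t, h1, h2, h3, h4, h5, h6, h7, h8, h9⟩ := h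
  refine ⟨i, s, j, t, h1, h2, ?_, ?_, ?_, ?_, ?_, ?_, fun u v huv => ?_⟩ <;>
    simp only [Matrix.add_apply]
  any_goals omega
  rw [h9 u v huv]

theorem matLT_add {n : ℕ} {B A : Mat n} (N : Mat n) (h : matLT n B A) :
    matLT n (B + N) (A + N) :=
  Relation.TransGen.lift (· + N) (fun _ _ => matStep_add N) _ _ h

theorem matStep_content {n : ℕ} {i j s t : Fin n} (h1 : i < s) (h2 : j < t)
    (l : List (Fin n × Fin n)) :
    matStep n (content ((i, j) :: (s, t) :: l)) (content ((i, t) :: (s, j) :: l)) := by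
  refine ⟨i, s, j, t, h1, h2, ?_, ?_, ?_, ?_, ?_, ?_, fun u v huv => ?_⟩ <;>
    simp only [content, List.count_cons, beq_iff_eq, Prod.mk.injEq] <;>
    grind

/-- A weight on matrices which strictly decreases along `2 × 2` submatrix transformations. -/
def matWeight {n : ℕ} (A : Mat n) : ℕ := ∑ i, ∑ j, A i j * ((i : ℕ) * (j : ℕ))

theorem matWeight_add {n : ℕ} (A B : Mat n) : matWeight (A + B) = matWeight A + matWeight B := by
  simp [matWeight, add_mul, Finset.sum_add_distrib]

theorem matWeight_single {n : ℕ} (i j : Fin n) :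
    matWeight (Matrix.single i j 1) = (i : ℕ) * (j : ℕ) := by
  simp [matWeight, Matrix.single_apply, ite_and]

theorem matWeight_lt_of_matStep {n : ℕ} {M M' : Mat n} (h : matStep n M M') :
    matWeight M' < matWeight M := by
  obtain ⟨i, s, j, t, h1, h2, h3, h4, h5, h6, h7, h8, h9⟩ := h
  have key : M + Matrix.single i t 1 + Matrix.single s j 1
      = M' + Matrix.single i j 1 + Matrix.single s t 1 := by
    ext u v
    simp only [Matrix.add_apply, Matrix.single_apply]
    have := h9 u v
    grind
  have hw := congrArg matWeight key
  simp only [matWeight_add, matWeight_single] at hw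
  have h1' : (i : ℕ) < s := h1
  have h2' : (j : ℕ) < t := h2
  nlinarith

theorem matWeight_lt_of_matLT {n : ℕ} {B A : Mat n} (h : matLT n B A) :
    matWeight B < matWeight A := by
  induction h with
  | single h => exact matWeight_lt_of_matStep h
  | tail _ h ih => exact (matWeight_lt_of_matStep h).trans ih

/-- Indicator that `a` strictly precedes `b` in the same row or in the same column. -/
def precedes {n : ℕ} (a b : Fin n × Fin n) : ℤ :=
  (if a.1 = b.1 ∧ a.2 < b.2 then 1 else 0) + (if a.2 = b.2 ∧ a.1 < b.1 then 1 else 0)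

theorem precedes_self {n : ℕ} (a : Fin n × Fin n) : precedes a a = 0 := by
  simp [precedes]

/-- The words of content `< A`, evaluated in the quantum matrix algebra. -/
def lowerWords {n : ℕ} (A : Mat n) : Set (Oq n) :=
  {v | ∃ l, matLT n (content l) A ∧ v = wordProd l}

/-- The signed number of pairs of letters in order of a word lying in a common row or column. -/
def pairSum {n : ℕ} : List (Fin n × Fin n) → ℤ
  | [] => 0
  | a :: l => (l.map fun b => precedes a b - precedes b a).sum + pairSum l

theorem wordProd_swap {n : ℕ} (a b : Fin n × Fin n) (l : List (Fin n × Fin n)) :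
    wordProd (a :: b :: l) - qq ^ (2 * (precedes a b - precedes b a)) • wordProd (b :: a :: l)
      ∈ qSpan n (lowerWords (content (a :: b :: l))) := by
  obtain ⟨i, j⟩ := a
  obtain ⟨s, t⟩ := b
  have diag : ∀ {i j s t : Fin n}, i < s → j < t →
      wordProd ((i, j) :: (s, t) :: l) - wordProd ((s, t) :: (i, j) :: l)
        ∈ qSpan n (lowerWords (content ((i, j) :: (s, t) :: l))) := by
    intro i j s t h1 h2
    have hw : wordProd ((i, t) :: (s, j) :: l)
        ∈ lowerWords (content ((i, j) :: (s, t) :: l)) :=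
      ⟨_, Relation.TransGen.single (matStep_content h1 h2 l), rfl⟩
    have e : wordProd ((i, j) :: (s, t) :: l) - wordProd ((s, t) :: (i, j) :: l)
        = qq ^ (2 : ℤ) • wordProd ((i, t) :: (s, j) :: l)
          - qq ^ (-2 : ℤ) • wordProd ((i, t) :: (s, j) :: l) := by
      simp only [wordProd_cons, ← mul_assoc]
      rw [xgen_diag h1 h2, add_mul, add_sub_cancel_left, smul_mul_assoc, zpow_neg, ← inv_zpow]
      exact_mod_cast sub_smul (qq ^ (2 : ℕ)) (qq⁻¹ ^ (2 : ℕ)) (xgen n i t * xgen n s j * wordProd l)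
    rw [e]
    exact sub_mem (zpow_smul_mem_qSpan_of_mem _ hw) (zpow_smul_mem_qSpan_of_mem _ hw)
  have of_eq : ∀ k : ℤ, 2 * (precedes (i, j) (s, t) - precedes (s, t) (i, j)) = k →
      xgen n i j * xgen n s t = qq ^ k • (xgen n s t * xgen n i j) →
      wordProd ((i, j) :: (s, t) :: l)
        - qq ^ (2 * (precedes (i, j) (s, t) - precedes (s, t) (i, j)))
          • wordProd ((s, t) :: (i, j) :: l)
        ∈ qSpan n (lowerWords (content ((i, j) :: (s, t) :: l))) := by
    intro k hk h
    have e : wordProd ((i, j) :: (s, t) :: l) = qq ^ k • wordProd ((s, t) :: (i, j) :: l) := by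
      simp only [wordProd_cons, ← mul_assoc]
      rw [h, smul_mul_assoc]
    rw [hk, e, sub_self]
    exact zero_mem _
  have inv_of {x y : Oq n} (h : x = qq ^ 2 • y) : y = qq ^ (-2 : ℤ) • x := by
    rw [h, zpow_neg]
    norm_cast
    rw [inv_smul_smul₀ (pow_ne_zero 2 qq_ne_zero)]
  rcases lt_trichotomy i s with h1 | rfl | h1
  · rcases lt_trichotomy j t with h2 | rfl | h2
    · have e : precedes (i, j) (s, t) - precedes (s, t) (i, j) = 0 := by
        simp [precedes, h1.ne, h1.ne', h2.ne, h2.ne']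
      rw [e, mul_zero, zpow_zero, one_smul]
      exact diag h1 h2
    · refine of_eq 2 (by simp [precedes, h1.ne, h1.ne', h1, h1.not_gt]) ?_
      exact_mod_cast xgen_col h1
    · refine of_eq 0 (by simp [precedes, h1.ne, h1.ne', h2.ne, h2.ne']) ?_
      rw [zpow_zero, one_smul, xgen_anti h1 h2]
  · rcases lt_trichotomy j t with h2 | rfl | h2
    · refine of_eq 2 (by simp [precedes, h2.ne, h2.ne', h2, h2.not_gt]) ?_
      exact_mod_cast xgen_row h2
    · exact of_eq 0 (by simp) (by simp)
    · exact of_eq (-2) (by simp [precedes, h2.ne, h2.ne', h2, h2.not_gt]) (inv_of (xgen_row h2))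
  · rcases lt_trichotomy j t with h2 | rfl | h2
    · refine of_eq 0 (by simp [precedes, h1.ne, h1.ne', h2.ne, h2.ne']) ?_
      rw [zpow_zero, one_smul, xgen_anti h1 h2]
    · exact of_eq (-2) (by simp [precedes, h1.ne, h1.ne', h1, h1.not_gt]) (inv_of (xgen_col h1))
    · have e : precedes (i, j) (s, t) - precedes (s, t) (i, j) = 0 := by
        simp [precedes, h1.ne, h1.ne', h2.ne, h2.ne']
      rw [e, mul_zero, zpow_zero, one_smul, ← neg_sub,
        content_perm (List.Perm.swap (s, t) (i, j) l)]
      exact neg_mem (diag h1 h2)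

/-- Words with the same letters agree up to a power of `q`, modulo words of lower content. -/
theorem wordProd_perm {n : ℕ} {l m : List (Fin n × Fin n)} (h : l.Perm m) :
    wordProd l - qq ^ (pairSum l - pairSum m) • wordProd m
      ∈ qSpan n (lowerWords (content l)) := by
  induction h with
  | nil => simp
  | @cons a l m hp ih =>
    have e : pairSum (a :: l) - pairSum (a :: m) = pairSum l - pairSum m := by
      simp only [pairSum]
      rw [(hp.map _).sum_eq]
      ring
    rw [e, wordProd_cons, wordProd_cons, ← mul_smul_comm, ← mul_sub]
    refine mul_mem_qSpan _ ?_ ih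
    rintro _ ⟨w, hw, rfl⟩
    refine ⟨a :: w, ?_, (wordProd_cons a w).symm⟩
    rw [content_cons, content_cons a l]
    exact matLT_add _ hw
  | swap a b l =>
    have e : pairSum (b :: a :: l) - pairSum (a :: b :: l)
        = 2 * (precedes b a - precedes a b) := by
      simp only [pairSum, List.map_cons, List.sum_cons]
      ring
    rw [e]
    exact wordProd_swap b a l
  | @trans l m r hlm _ ih₁ ih₂ =>
    rw [← content_perm hlm] at ih₂
    have h := add_mem ih₁ (zpow_smul_mem_qSpan (pairSum l - pairSum m) ih₂)
    rwa [smul_sub, smul_smul, ← zpow_add₀ qq_ne_zero, sub_add_sub_cancel,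
      sub_add_sub_cancel] at h

theorem pairSum_append {n : ℕ} (l m : List (Fin n × Fin n)) :
    pairSum (l ++ m) = pairSum l + pairSum m
      + (l.map fun a => (m.map fun b => precedes a b - precedes b a).sum).sum := by
  induction l with
  | nil => simp [pairSum]
  | cons a l ih =>
    simp only [List.cons_append, pairSum, ih, List.map_append, List.sum_append, List.map_cons,
      List.sum_cons]
    ring

theorem pairSum_reverse {n : ℕ} (l : List (Fin n × Fin n)) :
    pairSum l.reverse = -pairSum l := by
  induction l with
  | nil => simp [pairSum]
  | cons a l ih =>
    rw [List.reverse_cons, pairSum_append, ih]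
    have e : (l.map fun b => precedes b a - precedes a b).sum
        = -(l.map fun b => precedes a b - precedes b a).sum := by
      rw [List.sum_neg, List.map_map]
      simp [Function.comp_def]
    simp only [pairSum, List.map_nil, List.sum_nil, List.map_cons, List.sum_cons,
      List.map_reverse, List.sum_reverse, add_zero, e]
    ring

theorem pairSum_eq_of_pairwise {n : ℕ} {l : List (Fin n × Fin n)}
    (h : l.Pairwise fun a b => precedes b a = 0) :
    pairSum l = (l.map fun a => (l.map fun b => precedes a b).sum).sum := by
  induction l with
  | nil => simp [pairSum]
  | cons a l ih =>
    rw [List.pairwise_cons] at h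
    have e₁ : (l.map fun b => precedes a b - precedes b a)
        = l.map fun b => precedes a b :=
      List.map_congr_left fun b hb => by rw [h.1 b hb, sub_zero]
    have e₂ : (l.map fun b => precedes b a + (l.map fun c => precedes b c).sum)
        = l.map fun b => (l.map fun c => precedes b c).sum :=
      List.map_congr_left fun b hb => by rw [h.1 b hb, zero_add]
    simp only [pairSum, List.map_cons, List.sum_cons, precedes_self, ih h.2, e₁, e₂, zero_add]

theorem sum_map_eq_sum_content {n : ℕ} (l : List (Fin n × Fin n)) (f : Fin n × Fin n → ℤ) :
    (l.map f).sum = ∑ i, ∑ j, (content l i j : ℤ) * f (i, j) := by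
  induction l with
  | nil => simp [content]
  | cons a l ih =>
    rw [List.map_cons, List.sum_cons, ih, add_comm]
    simp only [content, List.count_cons, Nat.cast_add, add_mul, Finset.sum_add_distrib]
    congr 1
    simp [Prod.ext_iff, ite_and]

/-- The lexicographically ordered word of content `A`. -/
def lexWord {n : ℕ} (A : Mat n) : List (Fin n × Fin n) :=
  (List.finRange n).flatMap fun i =>
    (List.finRange n).flatMap fun j => List.replicate (A i j) (i, j)

theorem prod_flatMap {M α : Type*} [Monoid M] (l : List α) (f : α → List M) :
    (l.flatMap f).prod = (l.map fun a => (f a).prod).prod := by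
  induction l with
  | nil => simp
  | cons a l ih => simp [ih]

theorem wordProd_lexWord {n : ℕ} (A : Mat n) : wordProd (lexWord A) = xMon n A := by
  simp only [wordProd, lexWord, xMon, List.map_flatMap, prod_flatMap, List.map_replicate,
    List.prod_replicate]

theorem content_lexWord {n : ℕ} (A : Mat n) : content (lexWord A) = A := by
  ext i j
  have h : ∀ (u v : Fin n), List.count (i, j) (List.replicate (A u v) (u, v))
      = if u = i then (if v = j then A u v else 0) else 0 := by
    intro u v
    rw [List.count_replicate]
    simp [ite_and]
  simp only [content, lexWord, List.count_flatMap, Function.comp_def, h, ← Fin.sum_univ_def]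
  simp

theorem pairwise_lexWord {n : ℕ} (A : Mat n) :
    (lexWord A).Pairwise fun a b => precedes b a = 0 := by
  rw [lexWord, List.pairwise_flatMap]
  refine ⟨fun i _ => List.pairwise_flatMap.2 ⟨fun j _ => ?_, ?_⟩, ?_⟩
  · exact List.pairwise_replicate.2 (Or.inr (precedes_self _))
  · refine (List.pairwise_lt_finRange n).imp fun {j k} hjk x hx y hy => ?_
    rw [List.eq_of_mem_replicate hx, List.eq_of_mem_replicate hy]
    simp [precedes, hjk.not_gt]
  · refine (List.pairwise_lt_finRange n).imp fun {i k} hik x hx y hy => ?_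
    obtain ⟨j, -, hx⟩ := List.mem_flatMap.1 hx
    obtain ⟨t, -, hy⟩ := List.mem_flatMap.1 hy
    rw [List.eq_of_mem_replicate hx, List.eq_of_mem_replicate hy]
    simp [precedes, hik.not_gt, hik.ne']

theorem pairSum_lexWord {n : ℕ} (A : Mat n) : pairSum (lexWord A) = eExp n A := by
  rw [pairSum_eq_of_pairwise (pairwise_lexWord A)]
  simp only [sum_map_eq_sum_content, content_lexWord, eExp, precedes, mul_add,
    Finset.sum_add_distrib, Nat.cast_add, Nat.cast_sum, Finset.sum_filter]
  congr 1
  · refine Finset.sum_congr rfl fun i _ => ?_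
    rw [Finset.sum_comm]
    refine Finset.sum_congr rfl fun j _ => ?_
    simp only [ite_and, mul_ite, mul_one, mul_zero, Finset.sum_ite_irrel, Finset.sum_const_zero,
      Finset.sum_ite_eq, Finset.mem_univ, if_true, Finset.mul_sum]
    refine Finset.sum_congr rfl fun k _ => ?_
    split_ifs <;> simp [mul_comm]
  · rw [Finset.sum_comm]
    refine Finset.sum_congr rfl fun j _ => ?_
    simp only [ite_and, mul_ite, mul_one, mul_zero, Finset.sum_ite_eq, Finset.mem_univ, if_true,
      Finset.mul_sum]
    rw [Finset.sum_comm]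
    refine Finset.sum_congr rfl fun k _ => Finset.sum_congr rfl fun i _ => ?_
    split_ifs <;> simp [mul_comm]

theorem wordProd_mem_qSpan {n : ℕ} (l : List (Fin n × Fin n)) :
    wordProd l ∈ qSpan n {v | ∃ B, Relation.ReflTransGen (matStep n) (content l) B
      ∧ v = xMon n B} := by
  induction hw : matWeight (content l) using Nat.strong_induction_on generalizing l with
  | _ w ih =>
    have hp : l.Perm (lexWord (content l)) := by
      refine List.perm_iff_count.2 fun a => ?_
      exact (congrFun (congrFun (content_lexWord (content l)) a.1) a.2).symm
    have h := wordProd_perm hp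
    rw [wordProd_lexWord] at h
    rw [← sub_add_cancel (wordProd l) (qq ^ (pairSum l - pairSum (lexWord (content l)))
      • xMon n (content l))]
    refine add_mem (qSpan_le ?_ h)
      (zpow_smul_mem_qSpan_of_mem _ ⟨_, Relation.ReflTransGen.refl, rfl⟩)
    rintro _ ⟨m, hm, rfl⟩
    refine qSpan_le ?_ (ih _ (hw ▸ matWeight_lt_of_matLT hm) m rfl)
    rintro _ ⟨B, hB, rfl⟩
    exact subset_qSpan ⟨B, hm.to_reflTransGen.trans hB, rfl⟩

theorem mem_qSpan_xMon_of_mem {n : ℕ} {A : Mat n} {v : Oq n}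
    (hv : v ∈ qSpan n (lowerWords A)) :
    v ∈ qSpan n {v | ∃ B, matLT n B A ∧ v = xMon n B} := by
  refine qSpan_le ?_ hv
  rintro _ ⟨l, hl, rfl⟩
  refine qSpan_le ?_ (wordProd_mem_qSpan l)
  rintro _ ⟨B, hB, rfl⟩
  exact subset_qSpan ⟨B, Relation.TransGen.trans_left hl hB, rfl⟩

theorem inZLaurent_zpow (k : ℤ) : inZLaurent (qq ^ k) := by
  have h₁ : qq ∈ Subring.closure ({qq, qq⁻¹} : Set Kq) := Subring.subset_closure (by simp)
  have h₂ : qq⁻¹ ∈ Subring.closure ({qq, qq⁻¹} : Set Kq) := Subring.subset_closure (by simp)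
  cases k with
  | ofNat m => exact_mod_cast pow_mem h₁ m
  | negSucc m => rw [zpow_negSucc, ← inv_pow]; exact pow_mem h₂ _

theorem exists_sum_of_mem_qSpan {n : ℕ} {A : Mat n} {v : Oq n}
    (hv : v ∈ qSpan n {v | ∃ B, matLT n B A ∧ v = xMon n B}) :
    ∃ (F : Finset (Mat n)) (c : Mat n → Kq), (∀ B ∈ F, matLT n B A ∧ inZLaurent (c B)) ∧
      v = ∑ B ∈ F, c B • xMon n B := by
  classical
  have key : ∃ c : Mat n →₀ Kq, (∀ B, inZLaurent (c B)) ∧ (∀ B ∈ c.support, matLT n B A) ∧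
      v = c.sum fun B r => r • xMon n B := by
    induction hv using qSpan_induction with
    | mem k w hw =>
      obtain ⟨B, hB, rfl⟩ := hw
      refine ⟨Finsupp.single B (qq ^ k), fun C => ?_, fun C hC => ?_, ?_⟩
      · rw [Finsupp.single_apply]
        split_ifs
        · exact inZLaurent_zpow k
        · exact zero_mem _
      · rwa [Finset.mem_singleton.1 (Finsupp.support_single_subset hC)]
      · exact (Finsupp.sum_single_index (h := fun B r => r • xMon n B) (zero_smul _ _)).symm
    | zero => exact ⟨0, fun _ => zero_mem _, by simp, by simp⟩
    | add u v _ _ hu hv =>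
      obtain ⟨c, hc, hc', rfl⟩ := hu
      obtain ⟨d, hd, hd', rfl⟩ := hv
      refine ⟨c + d, fun B => add_mem (hc B) (hd B), fun B hB => ?_, ?_⟩
      · rcases Finset.mem_union.1 (Finsupp.support_add hB) with h | h
        · exact hc' B h
        · exact hd' B h
      · exact (Finsupp.sum_add_index' (h := fun B r => r • xMon n B) (fun _ => zero_smul _ _)
          (fun _ _ _ => add_smul _ _ _)).symm
    | neg u _ hu =>
      obtain ⟨c, hc, hc', rfl⟩ := hu
      refine ⟨-c, fun B => neg_mem (hc B), fun B hB => hc' B (by simpa using hB), ?_⟩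
      rw [Finsupp.sum_neg_index (h := fun B r => r • xMon n B) (fun _ => zero_smul _ _)]
      simp [Finsupp.sum]
  obtain ⟨c, hc, hc', rfl⟩ := key
  exact ⟨c.support, c, fun B hB => ⟨hc' B hB, hc B⟩, rfl⟩

theorem bar_wordProd {n : ℕ} {bar : Oq n → Oq n} (hbar : IsBar n bar)
    (l : List (Fin n × Fin n)) : bar (wordProd l) = wordProd l.reverse := by
  obtain ⟨-, -, -, hmul, hone, hgen, -⟩ := hbar
  induction l with
  | nil => simpa [wordProd] using hone
  | cons a l ih =>
    rw [wordProd_cons, hmul, ih, hgen, List.reverse_cons, wordProd_append]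
    simp [wordProd]

/-- The bar involution acts triangularly on the monomial basis:
`bar(x^A) = E(A)·x^A + Σ_B c_{BA}·x^B` with `E(A) = q^{-2(Σ_iΣ_{j>k}a_{ij}a_{ik} + Σ_iΣ_{j>k}a_{ji}a_{ki})}`,
each `c_{BA} ∈ ℤ[q, q⁻¹]`, and `c_{BA} ≠ 0` only if `B < A`. -/
theorem bar_triangular_on_monomials (n : ℕ) (bar : Oq n → Oq n) (hbar : IsBar n bar)
    (A : Mat n) :
    ∃ (F : Finset (Mat n)) (c : Mat n → Kq),
      (∀ B ∈ F, matLT n B A ∧ inZLaurent (c B)) ∧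
      bar (xMon n A) =
        (qq ^ (-(2 * (eExp n A : ℤ)))) • xMon n A + ∑ B ∈ F, c B • xMon n B := by
  have h := wordProd_perm (List.reverse_perm (lexWord A))
  rw [pairSum_reverse, pairSum_lexWord, ← bar_wordProd hbar, wordProd_lexWord,
    content_perm (List.reverse_perm _), content_lexWord] at h
  obtain ⟨F, c, hF, hc⟩ := exists_sum_of_mem_qSpan (mem_qSpan_xMon_of_mem h)
  refine ⟨F, c, hF, ?_⟩
  rw [← hc, show -(2 * (eExp n A : ℤ)) = -(eExp n A : ℤ) - eExp n A by ring,
    add_sub_cancel]
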